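/- Example 2 (non-existence): For every pair of reals α ≤ 0 ≤ β with α < β there is no function φ : [α, β] → ℝ with φ(0) = 0 such that for every x ∈ [α, β] the point (x, φ(x)) lies in G̃ and φ has derivative f(x, φ(x)) at x within [α, β] (one-sided at the endpoints), where f(x,y) = −4x(√y + 1) for x ≤ 0 and f(x,y) = −2x(2√(y − x²) + 1) for x ≥ 0. -/

import Mathlib

open Set

/-- Example 2: non-existence of a solution through the origin for
`y' = −4x(√y + 1)` (x ≤ 0), `y' = −2x(2√(y − x²) + 1)` (x ≥ 0). -/
theorem example2_nonexistence :
    ∀ α β : ℝ, α ≤ 0 → 0 ≤ β → α < β →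
      ¬ ∃ φ : ℝ → ℝ, φ 0 = 0 ∧
        ∀ x ∈ Icc α β,
          ((x ≤ 0 ∧ 0 ≤ φ x) ∨ (0 ≤ x ∧ x ^ 2 ≤ φ x)) ∧
          HasDerivWithinAt φ
            (if x ≤ 0 then -4 * x * (Real.sqrt (φ x) + 1)
             else -2 * x * (2 * Real.sqrt (φ x - x ^ 2) + 1))
            (Icc α β) x := by
  rintro α β hα hβ hαβ ⟨φ, h0, hφ⟩
  have hcont : ContinuousOn φ (Icc α β) := fun x hx => (hφ x hx).2.continuousWithinAt
  rcases hα.lt_or_eq with hα' | rfl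
  · have hmono : StrictMonoOn φ (Icc α 0) := by
      refine strictMonoOn_of_deriv_pos (convex_Icc α 0)
        (hcont.mono (Icc_subset_Icc_right hβ)) fun x hx => ?_
      rw [interior_Icc] at hx
      have hder := ((hφ x ⟨hx.1.le, hx.2.le.trans hβ⟩).2.hasDerivAt
        (Icc_mem_nhds hx.1 (hx.2.trans_le hβ)))
      rw [hder.deriv, if_pos hx.2.le]
      have hx0 : 0 < -4 * x := by linarith [hx.2]
      positivity
    have hlt := hmono (left_mem_Icc.2 hα) (right_mem_Icc.2 hα) hα'
    rcases (hφ α (left_mem_Icc.2 hαβ.le)).1 with h | h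
    · linarith [h.2]
    · linarith [h.1]
  · have hanti : StrictAntiOn φ (Icc 0 β) := by
      refine strictAntiOn_of_deriv_neg (convex_Icc 0 β) hcont fun x hx => ?_
      rw [interior_Icc] at hx
      have hder := ((hφ x ⟨hx.1.le, hx.2.le⟩).2.hasDerivAt (Icc_mem_nhds hx.1 hx.2))
      rw [hder.deriv, if_neg hx.1.not_ge]
      exact mul_neg_of_neg_of_pos (by linarith [hx.1]) (by positivity)
    have hlt := hanti (left_mem_Icc.2 hβ) (right_mem_Icc.2 hβ) hαβ
    rcases (hφ β (right_mem_Icc.2 hβ)).1 with h | h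
    · linarith [h.1]
    · linarith [h.2, sq_nonneg β]
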